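/- arXiv:1607.06388 — 3 statements merged into one kernel-verified Lean document; each statement's English description precedes it below -/
import Mathlib

section
/- Let (a₁, …, aₙ) be a nonempty list of integers with aᵢ ≥ 2 for every i, and write the negative continued fraction value [a₁, …, aₙ]⁻ = p/q in lowest terms with p, q > 0. Then ∑_{i=1}^{n} (aᵢ − 1) ≤ p − 1. -/
/-- The negative continued fraction `[a₁, …, aₙ]⁻`, defined by
`[aₙ]⁻ = aₙ` and `[a₁, …, aₙ]⁻ = a₁ − 1/[a₂, …, aₙ]⁻`.
The value on the empty list is junk. -/
def negContFrac : List ℤ → ℚ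
  | [] => 0
  | [a] => (a : ℚ)
  | a :: b :: rest => (a : ℚ) - 1 / negContFrac (b :: rest)

/-- If `x = p/q` in lowest terms with `p > 0`, then `a - 1/x = (a p - q)/p` in lowest terms. -/
theorem num_den_intCast_sub_one_div (a : ℤ) {x : ℚ} (hx : 0 < x.num) :
    ((a : ℚ) - 1 / x).num = a * x.num - x.den ∧ (((a : ℚ) - 1 / x).den : ℤ) = x.num := by
  have hcop : IsCoprime (a * x.num - x.den) x.num := by
    have hx_cop : IsCoprime x.num (x.den : ℤ) := Int.isCoprime_iff_gcd_eq_one.mpr x.reduced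
    obtain ⟨u, v, huv⟩ := hx_cop
    exact ⟨-v, u + v * a, by linear_combination huv⟩
  have hnat := Int.isCoprime_iff_gcd_eq_one.mp hcop
  have hval : (a : ℚ) - 1 / x = ((a * x.num - x.den : ℤ) : ℚ) / (x.num : ℤ) := by
    have hnum : (x.num : ℚ) ≠ 0 := by exact_mod_cast hx.ne'
    have hden : (x.den : ℚ) ≠ 0 := by exact_mod_cast x.den_ne_zero
    conv_lhs => rw [← Rat.num_div_den x]
    push_cast
    field_simp
  rw [hval]
  exact ⟨Rat.num_div_eq_of_coprime hx hnat, Rat.den_div_eq_of_coprime hx hnat⟩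

/-- The negative continued fraction of a list of integers `≥ 2` exceeds `1`, and its numerator
bounds the sum of the entries diminished by one. -/
theorem den_lt_num_and_sum_sub_one_lt_num (l : List ℤ) (hl : l ≠ []) (h : ∀ a ∈ l, 2 ≤ a) :
    ((negContFrac l).den : ℤ) < (negContFrac l).num ∧
      (l.map (fun a => a - 1)).sum < (negContFrac l).num := by
  induction l with
  | nil => exact absurd rfl hl
  | cons a t ih =>
    have ha : 2 ≤ a := h a (by simp)
    cases t with
    | nil => simp [negContFrac]; omega
    | cons b t =>
      obtain ⟨hden, hsum⟩ := ih (by simp) fun c hc => h c (List.mem_cons_of_mem a hc)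
      have hpos : 0 < (negContFrac (b :: t)).num := by omega
      obtain ⟨hn, hd⟩ := num_den_intCast_sub_one_div a hpos
      rw [negContFrac, hn, hd, List.map_cons, List.sum_cons]
      constructor <;> nlinarith

/-- If every entry of the nonempty list `l = (a₁, …, aₙ)` is at least `2`, and
`[a₁, …, aₙ]⁻ = p/q` in lowest terms with `p, q > 0` (so `p` is the numerator of the
rational number `negContFrac l`), then `∑ᵢ (aᵢ − 1) ≤ p − 1`. -/
theorem sum_sub_one_le_num_sub_one (l : List ℤ) (hl : l ≠ [])
    (h : ∀ a ∈ l, 2 ≤ a) :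
    (l.map (fun a => a - 1)).sum ≤ (negContFrac l).num - 1 :=
  Int.le_sub_one_of_lt (den_lt_num_and_sum_sub_one_lt_num l hl h).2
end

section
/- Let T be a finite abelian group of odd order, let t ∈ T, let k be a nonzero integer, and let φ : ℤ → ℤ × T be the group homomorphism defined by φ(n) = (2kn, n·t). Then the cokernel (ℤ × T)/im(φ) contains a nonzero element x with 2x = 0; in particular, this cokernel does not embed in any abelian group of odd order. -/
/-- An abelian group of odd order has no nonzero element killed by `2`. -/
theorem eq_zero_of_two_nsmul_eq_zero_of_odd_card {G : Type*} [AddCommGroup G] [Fintype G]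
    (hG : Odd (Fintype.card G)) {g : G} (hg : 2 • g = 0) : g = 0 := by
  obtain ⟨m, hm⟩ := hG
  have h : Fintype.card G • g = 0 := card_nsmul_eq_zero
  rwa [hm, add_nsmul, mul_comm, mul_nsmul', hg, nsmul_zero, zero_add, one_nsmul] at h

/-- Every element of an abelian group of odd order is divisible by `2`. -/
theorem exists_two_nsmul_eq_of_odd_card {G : Type*} [AddCommGroup G] [Fintype G]
    (hG : Odd (Fintype.card G)) (g : G) : ∃ s : G, 2 • s = g := by
  obtain ⟨m, hm⟩ := hG
  refine ⟨(m + 1) • g, ?_⟩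
  have h : Fintype.card G • g = 0 := card_nsmul_eq_zero
  rw [← mul_nsmul', show 2 * (m + 1) = Fintype.card G + 1 by omega, add_nsmul, h, zero_add,
    one_nsmul]


/-- Let `T` be a finite abelian group of odd order, `t ∈ T`, `k` a nonzero integer, and
`φ : ℤ → ℤ × T` the homomorphism `φ(n) = (2kn, n·t)`.  Then the cokernel `(ℤ × T)/im φ`
contains a nonzero element `x` with `2x = 0`; in particular the cokernel does not embed
in any (additive) abelian group of odd order. -/
theorem cokernel_has_two_torsion (T : Type*) [AddCommGroup T] [Fintype T]
    (hT : Odd (Fintype.card T)) (t : T) (k : ℤ) (hk : k ≠ 0)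
    (φ : ℤ →+ ℤ × T) (hφ : ∀ n : ℤ, φ n = (2 * k * n, n • t)) :
    (∃ x : (ℤ × T) ⧸ φ.range, x ≠ 0 ∧ 2 • x = 0) ∧
      ∀ (H : Type*) [AddCommGroup H] [Fintype H], Odd (Fintype.card H) →
        ∀ f : ((ℤ × T) ⧸ φ.range) →+ H, ¬ Function.Injective f := by
  have key : ∃ x : (ℤ × T) ⧸ φ.range, x ≠ 0 ∧ 2 • x = 0 := by
    obtain ⟨s, hs⟩ := exists_two_nsmul_eq_of_odd_card hT t
    refine ⟨QuotientAddGroup.mk (k, s), ?_, ?_⟩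
    · rw [Ne, QuotientAddGroup.eq_zero_iff]
      rintro ⟨n, hn⟩
      rw [hφ, Prod.mk.injEq] at hn
      have h : k * (2 * n) = k * 1 := by linarith [hn.1]
      have := mul_left_cancel₀ hk h
      omega
    · rw [← QuotientAddGroup.mk_nsmul, QuotientAddGroup.eq_zero_iff]
      exact ⟨1, by simp [hφ, hs]⟩
  refine ⟨key, fun H _ _ hH f hf => ?_⟩
  obtain ⟨x, hx, hx2⟩ := key
  refine hx ((map_eq_zero_iff f hf).1 (eq_zero_of_two_nsmul_eq_zero_of_odd_card hH ?_))
  rw [← map_nsmul, hx2, map_zero]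
end

section
/- Let G be a group containing elements σ₁, σ₂, σ₃, σ₄, σ₅ satisfying the braid relations of the braid group B₆ on six strands: σᵢσⱼ = σⱼσᵢ whenever |i − j| ≥ 2, and σᵢσᵢ₊₁σᵢ = σᵢ₊₁σᵢσᵢ₊₁ for 1 ≤ i ≤ 4. Set τ = σ₁σ₂σ₃σ₄σ₅. Then τ³·σ₃·τ·σ₃·τ·σ₃·σ₄·σ₅ = τ⁶. -/
/-- If `x` commutes with `b` and `y` with `a`, and `a`, `b` satisfy the braid relation, then
multiplication by `x * a * b * y` carries `a` to `b`. -/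
theorem SemiconjBy.of_braid_relation {S : Type*} [Semigroup S] {x a b y : S}
    (hx : Commute x b) (hy : Commute y a) (hab : a * b * a = b * a * b) :
    SemiconjBy (x * a * b * y) a b :=
  calc x * a * b * y * a = x * (a * b * (y * a)) := by simp only [mul_assoc]
    _ = x * (a * b * a) * y := by rw [hy.eq]; simp only [mul_assoc]
    _ = x * b * (a * b * y) := by rw [hab]; simp only [mul_assoc]
    _ = b * (x * a * b * y) := by rw [hx.eq]; simp only [mul_assoc]

/-- Let `G` be a group with elements `σ₁, …, σ₅` satisfying the braid relations of the
braid group `B₆`: `σᵢσⱼ = σⱼσᵢ` for `|i − j| ≥ 2` and `σᵢσᵢ₊₁σᵢ = σᵢ₊₁σᵢσᵢ₊₁`.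
With `τ = σ₁σ₂σ₃σ₄σ₅`, one has `τ³ σ₃ τ σ₃ τ σ₃ σ₄ σ₅ = τ⁶`. -/
theorem braid_gamma_eq_full_twist {G : Type*} [Group G] (σ : ℕ → G)
    (hcomm : ∀ i j : ℕ, 1 ≤ i → i ≤ 5 → 1 ≤ j → j ≤ 5 → i + 2 ≤ j →
      σ i * σ j = σ j * σ i)
    (hbraid : ∀ i : ℕ, 1 ≤ i → i ≤ 4 →
      σ i * σ (i + 1) * σ i = σ (i + 1) * σ i * σ (i + 1)) :
    (σ 1 * σ 2 * σ 3 * σ 4 * σ 5) ^ 3 * σ 3 * (σ 1 * σ 2 * σ 3 * σ 4 * σ 5) * σ 3 *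
        (σ 1 * σ 2 * σ 3 * σ 4 * σ 5) * σ 3 * σ 4 * σ 5
      = (σ 1 * σ 2 * σ 3 * σ 4 * σ 5) ^ 6 := by
  have comm : ∀ i j : ℕ, 1 ≤ i → j ≤ 5 → i + 2 ≤ j → Commute (σ i) (σ j) :=
    fun i j hi hj hij => hcomm i j hi (by omega) (by omega) hj hij
  have h13 := comm 1 3 (by norm_num) (by norm_num) (by norm_num)
  have h14 := comm 1 4 (by norm_num) (by norm_num) (by norm_num)
  have h24 := comm 2 4 (by norm_num) (by norm_num) (by norm_num)
  have h15 := comm 1 5 (by norm_num) (by norm_num) (by norm_num)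
  have h25 := comm 2 5 (by norm_num) (by norm_num) (by norm_num)
  have h35 := comm 3 5 (by norm_num) (by norm_num) (by norm_num)
  obtain ⟨τ, hτ⟩ : ∃ τ, τ = σ 1 * σ 2 * σ 3 * σ 4 * σ 5 := ⟨_, rfl⟩
  have shift₁ : SemiconjBy τ (σ 1) (σ 2) := by
    simpa [hτ, mul_assoc] using SemiconjBy.of_braid_relation (Commute.one_left (σ 2))
      ((h13.symm.mul_left h14.symm).mul_left h15.symm) (hbraid 1 (by norm_num) (by norm_num))
  have shift₂ : SemiconjBy τ (σ 2) (σ 3) := by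
    simpa [hτ, mul_assoc] using SemiconjBy.of_braid_relation h13
      (h24.symm.mul_left h25.symm) (hbraid 2 (by norm_num) (by norm_num))
  have shift₃ : SemiconjBy τ (σ 3) (σ 4) := by
    simpa [hτ, mul_assoc] using SemiconjBy.of_braid_relation (h14.mul_left h24)
      h35.symm (hbraid 3 (by norm_num) (by norm_num))
  have shift₄ : SemiconjBy τ (σ 4) (σ 5) := by
    simpa [hτ, mul_assoc] using SemiconjBy.of_braid_relation ((h15.mul_left h25).mul_left h35)
      (Commute.one_left (σ 4)) (hbraid 4 (by norm_num) (by norm_num))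
  have shift_sq : SemiconjBy (τ * τ) (σ 1 * σ 2 * σ 3) (σ 3 * σ 4 * σ 5) :=
    ((shift₂.mul_left shift₁).mul_right (shift₃.mul_left shift₂)).mul_right
      (shift₄.mul_left shift₃)
  rw [← hτ]
  calc τ ^ 3 * σ 3 * τ * σ 3 * τ * σ 3 * σ 4 * σ 5
      = τ ^ 3 * σ 3 * (τ * σ 3) * (τ * σ 3) * σ 4 * σ 5 := by simp only [mul_assoc]
    _ = τ ^ 3 * σ 3 * σ 4 * (τ * σ 4) * τ * σ 4 * σ 5 := by
      rw [shift₃.eq]; simp only [mul_assoc]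
    _ = τ ^ 3 * (σ 3 * σ 4 * σ 5 * (τ * τ)) * σ 4 * σ 5 := by
      rw [shift₄.eq]; simp only [mul_assoc]
    _ = τ ^ 3 * (τ * τ) * (σ 1 * σ 2 * σ 3 * σ 4 * σ 5) := by
      rw [← shift_sq.eq]; simp only [mul_assoc]
    _ = τ ^ 6 := by rw [← hτ]; group
end
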